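/- Let ξ ∈ (0,1), let k_v, k_c > 0 be constants, and let λ, ρ be degree distributions whose maximal degrees are at most k_v·a and k_c·a respectively, where a is defined by 1/a = ∫₀¹ ρ(x) dx; set b = 1/a, R = 1 − (∫₀¹ρ)/(∫₀¹λ), ΔR = (1−ξ) − R. Assume the successful decoding condition ξ·λ(1−ρ(1−x)) < x for all x ∈ (0, ξ], that b⁵ + b² < ξ, and let x satisfy b⁵ < x < ξ − b². Then (d/dx)[1 − λ^{-1}(x/ξ)] / (d/dx)[ρ(1−x)] ≥ 1 − k_c·b/(2(1−ξ)) − √(k_c)·B(ΔR, b, x)·(1−ξ)·a², where B(ΔR, b, x) = √( 2ΔR / ((ξ+ΔR)(1−ξ)·ρ(1−x)) ) and λ^{-1} is the inverse of λ on [0,1]. -/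

import Mathlib

open scoped BigOperators

/-- A degree distribution: a real polynomial `γ(x) = ∑_{i=2}^{D} γ_i x^(i-1)` whose
coefficients are nonnegative and sum to `1`; `D` (the largest index with `γ_D ≠ 0`)
is called the maximal degree. -/
structure DegreeDist where
  c : ℕ → ℝ
  D : ℕ
  two_le_D : 2 ≤ D
  nonneg : ∀ i, 0 ≤ c i
  supp : ∀ i, c i ≠ 0 → 2 ≤ i ∧ i ≤ D
  cD_ne : c D ≠ 0
  sum_eq_one : ∑ i ∈ Finset.Icc 2 D, c i = 1

/-- Evaluation of a degree distribution at a real `x`. -/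
noncomputable def DegreeDist.eval (γ : DegreeDist) (x : ℝ) : ℝ :=
  ∑ i ∈ Finset.Icc 2 γ.D, γ.c i * x ^ (i - 1)

theorem add_mul_sub_le_pow {w z : ℝ} (hw : 0 ≤ w) (hz : 0 ≤ z) (n : ℕ) :
    z ^ n + n * z ^ (n - 1) * (w - z) ≤ w ^ n := by
  induction n with
  | zero => simp
  | succ n ih =>
    rcases n with _ | n
    · simp
    · simp only [Nat.add_sub_cancel] at ih ⊢
      have h := mul_le_mul_of_nonneg_left ih hw
      have h2 : 0 ≤ ((n : ℝ) + 1) * z ^ n * (w - z) ^ 2 := by positivity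
      push_cast at h ⊢
      calc z ^ (n + 1 + 1) + ((n : ℝ) + 1 + 1) * z ^ (n + 1) * (w - z)
          = w * (z ^ (n + 1) + ((n : ℝ) + 1) * z ^ n * (w - z))
            - ((n : ℝ) + 1) * z ^ n * (w - z) ^ 2 := by ring
        _ ≤ w ^ (n + 1 + 1) := by rw [pow_succ' w (n + 1)]; linarith

theorem one_sub_pow_le_second_order {t : ℝ} (ht0 : 0 ≤ t) (ht1 : t ≤ 1) (n : ℕ) :
    (1 - t) ^ n ≤ 1 - n * t + n * (n - 1) / 2 * t ^ 2 := by
  induction n with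
  | zero => simp
  | succ n ih =>
    have h := mul_le_mul_of_nonneg_left ih (sub_nonneg.2 ht1)
    have h2 : 0 ≤ (n : ℝ) * (n - 1) / 2 * t ^ 3 := by
      rcases n with _ | n
      · simp
      · push_cast
        rw [add_sub_cancel_right]
        positivity
    rw [pow_succ']
    push_cast
    linarith

namespace DegreeDist

variable (γ : DegreeDist)

/-- The derivative of the polynomial `γ`. -/
noncomputable def derivEval (x : ℝ) : ℝ :=
  ∑ i ∈ Finset.Icc 2 γ.D, γ.c i * (((i - 1 : ℕ) : ℝ) * x ^ (i - 1 - 1))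

theorem hasDerivAt_eval (x : ℝ) : HasDerivAt γ.eval (γ.derivEval x) x := by
  unfold eval derivEval
  exact HasDerivAt.fun_sum fun i _ => (hasDerivAt_pow (i - 1) x).const_mul (γ.c i)

theorem continuous_eval : Continuous γ.eval := by
  unfold eval
  fun_prop

theorem continuous_derivEval : Continuous γ.derivEval := by
  unfold derivEval
  fun_prop

theorem eval_zero : γ.eval 0 = 0 := by
  refine Finset.sum_eq_zero fun i hi => ?_
  have := (Finset.mem_Icc.1 hi).1
  rw [zero_pow (by omega), mul_zero]

theorem eval_one : γ.eval 1 = 1 := by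
  simp [eval, γ.sum_eq_one]

theorem c_D_pos : 0 < γ.c γ.D := lt_of_le_of_ne (γ.nonneg _) γ.cD_ne.symm

theorem D_mem : γ.D ∈ Finset.Icc 2 γ.D := Finset.mem_Icc.2 ⟨γ.two_le_D, le_rfl⟩

theorem eval_nonneg {x : ℝ} (hx : 0 ≤ x) : 0 ≤ γ.eval x :=
  Finset.sum_nonneg fun i _ => mul_nonneg (γ.nonneg i) (pow_nonneg hx _)

theorem eval_pos {x : ℝ} (hx : 0 < x) : 0 < γ.eval x :=
  Finset.sum_pos' (fun i _ => mul_nonneg (γ.nonneg i) (pow_nonneg hx.le _))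
    ⟨γ.D, γ.D_mem, mul_pos γ.c_D_pos (pow_pos hx _)⟩

theorem derivEval_nonneg {x : ℝ} (hx : 0 ≤ x) : 0 ≤ γ.derivEval x :=
  Finset.sum_nonneg fun i _ => mul_nonneg (γ.nonneg i) (by positivity)

theorem derivEval_pos {x : ℝ} (hx : 0 < x) : 0 < γ.derivEval x := by
  refine Finset.sum_pos' (fun i _ => mul_nonneg (γ.nonneg i) (by positivity))
    ⟨γ.D, γ.D_mem, mul_pos γ.c_D_pos ?_⟩
  have h : 0 < γ.D - 1 := by have := γ.two_le_D; omega
  have : (0 : ℝ) < ((γ.D - 1 : ℕ) : ℝ) := by exact_mod_cast h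
  positivity

theorem strictMonoOn_eval : StrictMonoOn γ.eval (Set.Ici 0) :=
  strictMonoOn_of_deriv_pos (convex_Ici 0) γ.continuous_eval.continuousOn fun x hx => by
    rw [interior_Ici] at hx
    rw [(γ.hasDerivAt_eval x).deriv]
    exact γ.derivEval_pos hx

theorem eval_mem_Icc {x : ℝ} (hx : x ∈ Set.Icc (0 : ℝ) 1) : γ.eval x ∈ Set.Icc (0 : ℝ) 1 := by
  refine ⟨γ.eval_nonneg hx.1, ?_⟩
  rw [← γ.eval_one]
  exact γ.strictMonoOn_eval.monotoneOn hx.1 (Set.mem_Ici.2 zero_le_one) hx.2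

theorem tangent_le_eval {w z : ℝ} (hw : 0 ≤ w) (hz : 0 ≤ z) :
    γ.eval z + γ.derivEval z * (w - z) ≤ γ.eval w := by
  unfold eval derivEval
  rw [Finset.sum_mul, ← Finset.sum_add_distrib]
  refine Finset.sum_le_sum fun i _ => ?_
  have h := mul_le_mul_of_nonneg_left (add_mul_sub_le_pow hw hz (i - 1)) (γ.nonneg i)
  linarith

theorem mul_derivEval (y : ℝ) :
    y * γ.derivEval y = ∑ i ∈ Finset.Icc 2 γ.D, γ.c i * (((i - 1 : ℕ) : ℝ) * y ^ (i - 1)) := by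
  unfold derivEval
  rw [Finset.mul_sum]
  refine Finset.sum_congr rfl fun i hi => ?_
  have h := (Finset.mem_Icc.1 hi).1
  obtain ⟨k, rfl⟩ := Nat.exists_eq_add_of_le h
  have h1 : 2 + k - 1 = k + 1 := by omega
  rw [h1, Nat.add_sub_cancel]
  ring

theorem eval_le_mul_derivEval {y : ℝ} (hy : 0 ≤ y) : γ.eval y ≤ y * γ.derivEval y := by
  rw [mul_derivEval]
  refine Finset.sum_le_sum fun i hi => mul_le_mul_of_nonneg_left ?_ (γ.nonneg i)
  have h := (Finset.mem_Icc.1 hi).1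
  have h1 : (1 : ℝ) ≤ ((i - 1 : ℕ) : ℝ) := by exact_mod_cast (by omega : 1 ≤ i - 1)
  exact le_mul_of_one_le_left (pow_nonneg hy _) h1

theorem eval_one_sub_mul_le {t y : ℝ} (ht0 : 0 ≤ t) (ht1 : t ≤ 1) (hy : 0 ≤ y) :
    γ.eval ((1 - t) * y) ≤
      γ.eval y - t * (y * γ.derivEval y) + γ.D / 2 * t ^ 2 * (y * γ.derivEval y) := by
  rw [mul_derivEval]
  unfold eval
  rw [Finset.mul_sum, Finset.mul_sum, ← Finset.sum_sub_distrib, ← Finset.sum_add_distrib]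
  refine Finset.sum_le_sum fun i hi => ?_
  have hi' : ((i - 1 : ℕ) : ℝ) - 1 ≤ γ.D := by
    have h : i - 1 ≤ γ.D := by have := (Finset.mem_Icc.1 hi).2; omega
    have : ((i - 1 : ℕ) : ℝ) ≤ γ.D := by exact_mod_cast h
    linarith
  set n : ℕ := i - 1
  have hc : 0 ≤ γ.c i * y ^ n := mul_nonneg (γ.nonneg i) (pow_nonneg hy _)
  have h1 := one_sub_pow_le_second_order ht0 ht1 n
  have h2 : (n : ℝ) * (n - 1) / 2 * t ^ 2 ≤ γ.D / 2 * t ^ 2 * n := by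
    have := mul_le_mul_of_nonneg_left hi' (by positivity : 0 ≤ (n : ℝ) / 2 * t ^ 2)
    linarith
  have h3 := mul_le_mul_of_nonneg_left (h1.trans (add_le_add_right h2 _)) hc
  rw [mul_pow]
  linarith

theorem integral_eval_pos : 0 < ∫ x in (0 : ℝ)..1, γ.eval x :=
  intervalIntegral.intervalIntegral_pos_of_pos_on (γ.continuous_eval.intervalIntegrable 0 1)
    (fun _ hx => γ.eval_pos hx.1) zero_lt_one

theorem integral_one_sub_mul_derivEval :
    ∫ w in (0 : ℝ)..1, (1 - w) * γ.derivEval w = ∫ w in (0 : ℝ)..1, γ.eval w := by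
  have hd := γ.continuous_derivEval
  have he := γ.continuous_eval
  have h := intervalIntegral.integral_mul_deriv_eq_deriv_mul (a := 0) (b := 1)
    (u := fun w : ℝ => 1 - w) (u' := fun _ => -1) (v := γ.eval) (v' := γ.derivEval)
    (fun w _ => by simpa using (hasDerivAt_id w).const_sub 1) (fun w _ => γ.hasDerivAt_eval w)
    (continuous_const.intervalIntegrable 0 1)
    (hd.intervalIntegrable 0 1)
  rw [h]
  simp [γ.eval_zero]

end DegreeDist

/-- The triangle with height `δ` at `x` and hypotenuse of slope `-G` lies to the left of `1`, so
its area bounds the integral from below. -/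
theorem sq_div_le_integral_max {x δ G : ℝ} (hδ : 0 ≤ δ) (hG : 0 < G) (hle : δ ≤ G * (1 - x)) :
    δ ^ 2 / (2 * G) ≤ ∫ y in x..1, max 0 (δ - G * (y - x)) := by
  have hc1 : x ≤ x + δ / G := by have := div_nonneg hδ hG.le; linarith
  have hc2 : x + δ / G ≤ 1 := by
    have : δ / G ≤ 1 - x := (div_le_iff₀ hG).2 (by linarith)
    linarith
  have hM : Continuous fun y : ℝ => max 0 (δ - G * (y - x)) := by fun_prop
  have hN : Continuous fun y : ℝ => δ - G * (y - x) := by fun_prop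
  rw [← intervalIntegral.integral_add_adjacent_intervals (hM.intervalIntegrable x (x + δ / G))
    (hM.intervalIntegrable _ _)]
  have h1 : 0 ≤ ∫ y in (x + δ / G)..1, max 0 (δ - G * (y - x)) :=
    intervalIntegral.integral_nonneg hc2 fun y _ => le_max_left _ _
  have h2 : ∫ y in x..(x + δ / G), (δ - G * (y - x)) ≤
      ∫ y in x..(x + δ / G), max 0 (δ - G * (y - x)) :=
    intervalIntegral.integral_mono_on hc1 (hN.intervalIntegrable _ _) (hM.intervalIntegrable _ _)
      fun y _ => le_max_right _ _
  have h3 : ∫ y in x..(x + δ / G), (δ - G * (y - x)) = δ ^ 2 / (2 * G) := by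
    rw [intervalIntegral.integral_eq_sub_of_hasDerivAt
      (f := fun y => δ * (y - x) - G * ((y - x) ^ 2 / 2)) (fun y _ => ?_)
      (hN.intervalIntegrable _ _)]
    · field_simp
      ring
    · have h : HasDerivAt (fun y => y - x) 1 y := (hasDerivAt_id y).sub_const x
      refine ((h.const_mul δ).fun_sub (((h.fun_pow 2).div_const 2).const_mul G)).congr_deriv ?_
      simp
  linarith

/-- The vertical gap between the curves `ρ(1-y)` and `1 - λ⁻¹(y/ξ)` at `y = ξ λ(z)` is controlled
by the area `∫ρ - ξ∫λ` between them. -/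
theorem sq_gap_div_le_area (lam ρ : DegreeDist) {ξ z : ℝ} (hξ0 : 0 < ξ) (hξ1 : ξ ≤ 1)
    (hz : z ∈ Set.Icc (0 : ℝ) 1) (hx1 : ξ * lam.eval z < 1)
    (hdec : ∀ x ∈ Set.Ioc (0 : ℝ) ξ, ξ * lam.eval (1 - ρ.eval (1 - x)) < x)
    (hgap : 0 ≤ ρ.eval (1 - ξ * lam.eval z) - (1 - z)) :
    (ρ.eval (1 - ξ * lam.eval z) - (1 - z)) ^ 2 / (2 * ρ.derivEval (1 - ξ * lam.eval z)) ≤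
      (∫ y in (0 : ℝ)..1, ρ.eval y) - ξ * ∫ y in (0 : ℝ)..1, lam.eval y := by
  set x := ξ * lam.eval z with hx
  set G := ρ.derivEval (1 - x)
  set δ := ρ.eval (1 - x) - (1 - z) with hδ
  have hG : 0 < G := ρ.derivEval_pos (by linarith)
  have hlc := lam.continuous_eval
  have hldc := lam.continuous_derivEval
  have hrc := ρ.continuous_eval
  -- the tangent line to `y ↦ ρ(1-y)` at `x` stays below it
  have htan : ∀ y ≤ 1, ρ.eval (1 - x) - G * (y - x) ≤ ρ.eval (1 - y) := fun y hy => by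
    have := ρ.tangent_le_eval (sub_nonneg.2 hy) (sub_nonneg.2 hx1.le)
    linarith
  have hle : δ ≤ G * (1 - x) := by
    have := htan 1 le_rfl
    rw [sub_self, ρ.eval_zero] at this
    linarith [hz.2]
  refine (sq_div_le_integral_max hgap hG hle).trans ?_
  let M : ℝ → ℝ := fun y => max 0 (δ - G * (y - x))
  have hM : Continuous M := by fun_prop
  have hg : Continuous fun y => ρ.eval (1 - y) := by fun_prop
  have hderiv : ∀ w : ℝ, HasDerivAt (fun w => ξ * lam.eval w) (ξ * lam.derivEval w) w :=
    fun w => (lam.hasDerivAt_eval w).const_mul ξ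
  -- integrals over `[ξ λ(p), ξ λ(q)]` in the coordinate `w = λ⁻¹(y/ξ)`
  have hsubst : ∀ (F : ℝ → ℝ), Continuous F → ∀ p q : ℝ,
      ∫ w in p..q, F (ξ * lam.eval w) * (ξ * lam.derivEval w) =
        ∫ y in (ξ * lam.eval p)..(ξ * lam.eval q), F y := fun F hF p q =>
    intervalIntegral.integral_comp_mul_deriv (fun w _ => hderiv w)
      (by fun_prop) hF
  have hgap_nonneg : ∀ w ∈ Set.Icc (0 : ℝ) 1, 0 ≤ ρ.eval (1 - ξ * lam.eval w) - (1 - w) := by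
    intro w hw
    rcases hw.1.eq_or_lt with rfl | hw0
    · simp [lam.eval_zero, ρ.eval_one]
    · have hl := lam.eval_mem_Icc hw
      have hy : ξ * lam.eval w ∈ Set.Ioc 0 ξ :=
        ⟨mul_pos hξ0 (lam.eval_pos hw0), mul_le_of_le_one_right hξ0.le hl.2⟩
      have h1 := lt_of_mul_lt_mul_left (hdec _ hy) hξ0.le
      by_contra! hcon
      have h2 := lam.strictMonoOn_eval hw.1 (Set.mem_Ici.2 (by linarith [hw.1]))
        (by linarith : w < 1 - ρ.eval (1 - ξ * lam.eval w))
      linarith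
  have hb : ∫ y in (0 : ℝ)..1, ρ.eval y =
      (∫ y in (0 : ℝ)..ξ, ρ.eval (1 - y)) + ∫ y in ξ..1, ρ.eval (1 - y) := by
    rw [intervalIntegral.integral_add_adjacent_intervals (hg.intervalIntegrable _ _)
      (hg.intervalIntegrable _ _), intervalIntegral.integral_comp_sub_left (fun y => ρ.eval y) 1]
    simp
  have hbξ := hsubst _ hg 0 1
  rw [lam.eval_zero, lam.eval_one, mul_zero, mul_one] at hbξ
  have hlam : ξ * ∫ y in (0 : ℝ)..1, lam.eval y =
      ∫ w in (0 : ℝ)..1, (1 - w) * (ξ * lam.derivEval w) := by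
    rw [← lam.integral_one_sub_mul_derivEval, ← intervalIntegral.integral_const_mul]
    exact intervalIntegral.integral_congr fun w _ => by ring
  have hMs := hsubst _ hM z 1
  rw [lam.eval_one, mul_one] at hMs
  let H : ℝ → ℝ := fun w => (ρ.eval (1 - ξ * lam.eval w) - (1 - w)) * (ξ * lam.derivEval w)
  have hH : Continuous H := by fun_prop
  have hdiff : (∫ y in (0 : ℝ)..ξ, ρ.eval (1 - y)) - ξ * ∫ y in (0 : ℝ)..1, lam.eval y =
      (∫ w in (0 : ℝ)..z, H w) + ∫ w in z..1, H w := by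
    rw [intervalIntegral.integral_add_adjacent_intervals (hH.intervalIntegrable _ _)
      (hH.intervalIntegrable _ _), hlam, ← hbξ, ← intervalIntegral.integral_sub
      (Continuous.intervalIntegrable (by fun_prop) _ _)
      (Continuous.intervalIntegrable (by fun_prop) _ _)]
    exact intervalIntegral.integral_congr fun w _ => by simp only [H]; ring
  have hH0 : 0 ≤ ∫ w in (0 : ℝ)..z, H w := intervalIntegral.integral_nonneg hz.1 fun w hw =>
    mul_nonneg (hgap_nonneg w ⟨hw.1, hw.2.trans hz.2⟩)
      (mul_nonneg hξ0.le (lam.derivEval_nonneg hw.1))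
  have hH1 : ∫ w in z..1, M (ξ * lam.eval w) * (ξ * lam.derivEval w) ≤ ∫ w in z..1, H w := by
    refine intervalIntegral.integral_mono_on hz.2
      (Continuous.intervalIntegrable (by fun_prop) _ _) (hH.intervalIntegrable _ _) fun w hw => ?_
    have hw' : w ∈ Set.Icc (0 : ℝ) 1 := ⟨hz.1.trans hw.1, hw.2⟩
    refine mul_le_mul_of_nonneg_right (max_le (hgap_nonneg w hw') ?_)
      (mul_nonneg hξ0.le (lam.derivEval_nonneg hw'.1))
    have := htan (ξ * lam.eval w)
      (mul_le_one₀ hξ1 (lam.eval_nonneg hw'.1) (lam.eval_mem_Icc hw').2)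
    linarith [hw.1]
  have hM1 : ∫ y in ξ..1, M y ≤ ∫ y in ξ..1, ρ.eval (1 - y) := by
    refine intervalIntegral.integral_mono_on hξ1 (hM.intervalIntegrable _ _)
      (hg.intervalIntegrable _ _) fun y hy => max_le (ρ.eval_nonneg (by linarith [hy.2])) ?_
    linarith [htan y hy.2, hz.2]
  have hMsplit := intervalIntegral.integral_add_adjacent_intervals
    (hM.intervalIntegrable (μ := MeasureTheory.volume) x ξ) (hM.intervalIntegrable ξ 1)
  change ∫ y in x..1, M y ≤ _
  linarith

/-- A left and right inverse of a degree distribution maps `(0, 1)` to itself. -/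
theorem inverse_mem_Ioo (lam : DegreeDist) {linv : ℝ → ℝ}
    (hmaps : ∀ y ∈ Set.Icc (0 : ℝ) 1, linv y ∈ Set.Icc (0 : ℝ) 1)
    (hright : ∀ y ∈ Set.Icc (0 : ℝ) 1, lam.eval (linv y) = y)
    {y : ℝ} (hy : y ∈ Set.Ioo (0 : ℝ) 1) : linv y ∈ Set.Ioo (0 : ℝ) 1 := by
  have hyI : y ∈ Set.Icc (0 : ℝ) 1 := ⟨hy.1.le, hy.2.le⟩
  have hr := hright y hyI
  refine ⟨(hmaps y hyI).1.lt_of_ne fun h => ?_, (hmaps y hyI).2.lt_of_ne fun h => ?_⟩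
  · rw [← h, lam.eval_zero] at hr
    exact hy.1.ne hr
  · rw [h, lam.eval_one] at hr
    exact hy.2.ne' hr

/-- Inverse function rule for the inverse of a degree distribution on `[0, 1]`. -/
theorem hasDerivAt_inverse (lam : DegreeDist) {linv : ℝ → ℝ}
    (hmaps : ∀ y ∈ Set.Icc (0 : ℝ) 1, linv y ∈ Set.Icc (0 : ℝ) 1)
    (hleft : ∀ x ∈ Set.Icc (0 : ℝ) 1, linv (lam.eval x) = x)
    (hright : ∀ y ∈ Set.Icc (0 : ℝ) 1, lam.eval (linv y) = y)
    {y : ℝ} (hy : y ∈ Set.Ioo (0 : ℝ) 1) :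
    HasDerivAt linv (lam.derivEval (linv y))⁻¹ y := by
  have hz := inverse_mem_Ioo lam hmaps hright hy
  have hmono : StrictMonoOn linv (Set.Icc 0 1) := fun p hp q hq hpq => by
    by_contra! hcon
    have := lam.strictMonoOn_eval.monotoneOn (hmaps q hq).1 (hmaps p hp).1 hcon
    rw [hright p hp, hright q hq] at this
    linarith
  have hsurj : Set.Icc (0 : ℝ) 1 ⊆ linv '' Set.Icc 0 1 := fun w hw =>
    ⟨lam.eval w, lam.eval_mem_Icc hw, hleft w hw⟩
  have hcont : ContinuousAt linv y := hmono.continuousAt_of_image_mem_nhds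
    (Icc_mem_nhds hy.1 hy.2) (Filter.mem_of_superset (Icc_mem_nhds hz.1 hz.2) hsurj)
  exact HasDerivAt.of_local_left_inverse hcont (lam.hasDerivAt_eval _)
    (lam.derivEval_pos hz.1).ne'
    (Filter.Eventually.mono (Icc_mem_nhds hy.1 hy.2) fun s hs => hright s hs)

/-- lower bound on `(d/dx)[1−λ⁻¹(x/ξ)] / (d/dx)[ρ(1−x)]` for
`b⁵ < x < ξ − b²`. -/
theorem stmt6 (ξ a b R dR kv kc : ℝ) (hξ : ξ ∈ Set.Ioo (0:ℝ) 1)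
    (hkv : 0 < kv) (hkc : 0 < kc)
    (lam ρ : DegreeDist)
    (linv : ℝ → ℝ)
    (hmaps : ∀ y ∈ Set.Icc (0:ℝ) 1, linv y ∈ Set.Icc (0:ℝ) 1)
    (hleft : ∀ x ∈ Set.Icc (0:ℝ) 1, linv (lam.eval x) = x)
    (hright : ∀ y ∈ Set.Icc (0:ℝ) 1, lam.eval (linv y) = y)
    (ha : 1 / a = ∫ x in (0:ℝ)..1, ρ.eval x)
    (hb : b = 1 / a)
    (hR : R = 1 - (∫ x in (0:ℝ)..1, ρ.eval x) / (∫ x in (0:ℝ)..1, lam.eval x))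
    (hdR : dR = (1 - ξ) - R)
    (hdegv : (lam.D : ℝ) ≤ kv * a) (hdegc : (ρ.D : ℝ) ≤ kc * a)
    (hdec : ∀ x ∈ Set.Ioc (0:ℝ) ξ, ξ * lam.eval (1 - ρ.eval (1 - x)) < x)
    (hbs : b ^ 5 + b ^ 2 < ξ)
    (x : ℝ) (hx1 : b ^ 5 < x) (hx2 : x < ξ - b ^ 2) :
    1 - kc * b / (2 * (1 - ξ)) -
        Real.sqrt kc * Real.sqrt (2 * dR / ((ξ + dR) * (1 - ξ) * ρ.eval (1 - x))) *
          (1 - ξ) * a ^ 2 ≤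
      deriv (fun t => 1 - linv (t / ξ)) x / deriv (fun t => ρ.eval (1 - t)) x := by
  obtain ⟨hξ0, hξ1⟩ := hξ
  have hb_pos : 0 < b := by
    rw [hb, ha]
    exact ρ.integral_eval_pos
  have ha_pos : 0 < a := by
    rw [hb] at hb_pos
    exact one_div_pos.1 hb_pos
  have hab : a * b = 1 := by rw [hb, mul_one_div_cancel ha_pos.ne']
  have hx0 : 0 < x := (pow_pos hb_pos 5).trans hx1
  have hxξ : x < ξ := by linarith [pow_pos hb_pos 2]
  have hy : x / ξ ∈ Set.Ioo (0 : ℝ) 1 := ⟨div_pos hx0 hξ0, (div_lt_one hξ0).2 hxξ⟩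
  have hz := inverse_mem_Ioo lam hmaps hright hy
  have hlin := hasDerivAt_inverse lam hmaps hleft hright hy
  have hlz := hright (x / ξ) ⟨hy.1.le, hy.2.le⟩
  set z := linv (x / ξ)
  have hξz : ξ * lam.eval z = x := by rw [hlz, mul_div_cancel₀ _ hξ0.ne']
  set G := ρ.derivEval (1 - x) with hG_def
  set P := ρ.eval (1 - x) with hP_def
  have h1x : 0 < 1 - x := by linarith
  have hG : 0 < G := ρ.derivEval_pos h1x
  have hP : 0 < P := ρ.eval_pos h1x
  set L := ξ * lam.derivEval z with hL_def
  have hL : 0 < L := mul_pos hξ0 (lam.derivEval_pos hz.1)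
  have hderiv1 : deriv (fun t => 1 - linv (t / ξ)) x = -(1 / L) := by
    have h := (HasDerivAt.comp x hlin ((hasDerivAt_id x).div_const ξ)).const_sub 1
    refine h.deriv.trans ?_
    rw [hL_def]
    field_simp
  have hderiv2 : deriv (fun t => ρ.eval (1 - t)) x = -G := by
    have h := HasDerivAt.comp x (ρ.hasDerivAt_eval (1 - x)) ((hasDerivAt_id x).const_sub 1)
    refine h.deriv.trans ?_
    rw [mul_neg_one]
  rw [hderiv1, hderiv2, neg_div_neg_eq, div_div]
  set u := kc * b / (2 * (1 - ξ)) with hu_def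
  have h1ξ : 0 < 1 - ξ := by linarith
  have hroot : 0 ≤ √kc * √(2 * dR / ((ξ + dR) * (1 - ξ) * P)) * (1 - ξ) * a ^ 2 := by positivity
  have hLG : 0 < 1 / (L * G) := by positivity
  rcases le_or_gt 1 u with hu1 | hu1
  · linarith
  have hkca : 2 ≤ kc * a := by
    have : (2 : ℝ) ≤ ρ.D := by exact_mod_cast ρ.two_le_D
    linarith
  have hkcb : 2 * b ≤ kc := by
    calc 2 * b ≤ kc * a * b := mul_le_mul_of_nonneg_right hkca hb_pos.le
      _ = kc := by rw [mul_assoc, hab, mul_one]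
  set t := b ^ 2 / (1 - ξ) with ht_def
  have ht0 : 0 < t := by positivity
  have htu : t ≤ u := by
    rw [ht_def, hu_def, div_le_div_iff₀ h1ξ (by positivity)]
    have := mul_le_mul_of_nonneg_right hkcb (mul_pos hb_pos h1ξ).le
    linarith
  have ht1 : t < 1 := htu.trans_lt hu1
  have hut : kc * a / 2 * t = u := by
    rw [ht_def, hu_def]
    field_simp
    linear_combination hab
  set δ := P - (1 - z) with hδ_def
  -- decoding condition combined with the tangent line of `λ` at `z`
  have hcomp : ∀ y, 0 < y → y ≤ 1 → L * (1 - ρ.eval (1 - y) - z) ≤ y - x := by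
    intro y hy0 hy1
    have hv := ρ.eval_mem_Icc (x := 1 - y) ⟨by linarith, by linarith⟩
    have hw : 1 - ρ.eval (1 - y) ∈ Set.Icc (0 : ℝ) 1 := ⟨by linarith [hv.2], by linarith [hv.1]⟩
    have h1 : ξ * lam.eval (1 - ρ.eval (1 - y)) ≤ y := by
      rcases le_or_gt y ξ with h | h
      · exact (hdec y ⟨hy0, h⟩).le
      · exact (mul_le_of_le_one_right hξ0.le (lam.eval_mem_Icc hw).2).trans h.le
    have h2 := mul_le_mul_of_nonneg_left (lam.tangent_le_eval hw.1 hz.1.le) hξ0.le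
    rw [hL_def]
    linarith
  have hδ0 : 0 ≤ δ := by
    have h := hcomp x hx0 (by linarith)
    rw [sub_self] at h
    have := nonpos_of_mul_nonpos_right h hL
    linarith
  have harea := sq_gap_div_le_area lam ρ hξ0 hξ1.le ⟨hz.1.le, hz.2.le⟩ (by linarith) hdec
    (by rw [hξz]; exact hδ0)
  rw [hξz, ← ha, ← hb, ← hδ_def, ← hG_def] at harea
  have hΛ := lam.integral_eval_pos
  rw [← ha, ← hb] at hR
  set Λ := ∫ y in (0 : ℝ)..1, lam.eval y
  have hsum : ξ + dR = b / Λ := by linarith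
  have hquot : 2 * dR / ((ξ + dR) * (1 - ξ) * P) = 2 * (b - ξ * Λ) / (b * (1 - ξ) * P) := by
    have hdR' : dR = b / Λ - ξ := by linarith
    rw [hsum, hdR']
    field_simp
  rw [hquot]
  set S := (1 - x) * G with hS_def
  have hS : 0 < S := mul_pos h1x hG
  have hPS : P ≤ S := ρ.eval_le_mul_derivEval h1x.le
  -- the second-order expansion of `ρ` at `1 - x`
  have hstep : t * S * (1 - u) ≤ δ + t * (1 - x) / L := by
    have h1 := hcomp (x + t * (1 - x)) (by positivity) (by
      have := mul_le_mul_of_nonneg_right ht1.le h1x.le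
      linarith)
    rw [show 1 - (x + t * (1 - x)) = (1 - t) * (1 - x) by ring, ← le_div_iff₀' hL,
      show x + t * (1 - x) - x = t * (1 - x) by ring] at h1
    have h2 := ρ.eval_one_sub_mul_le ht0.le ht1.le h1x.le
    rw [← hS_def, ← hP_def] at h2
    have h3 : (ρ.D : ℝ) / 2 * t ^ 2 * S ≤ u * t * S := by
      rw [← hut]
      have := mul_le_mul_of_nonneg_right hdegc (by positivity : 0 ≤ t ^ 2 * S / 2)
      linarith
    linarith
  have hδS : δ / S ≤ √kc * √(2 * (b - ξ * Λ) / (b * (1 - ξ) * P)) := by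
    rw [← Real.sqrt_mul hkc.le]
    refine Real.le_sqrt_of_sq_le ?_
    have hA : 0 ≤ b - ξ * Λ := le_trans (by positivity) harea
    have h1 : δ ^ 2 ≤ 2 * G * (b - ξ * Λ) := by
      rw [div_le_iff₀ (by positivity)] at harea
      linarith
    have h2 : G * (b * (1 - ξ) * P) ≤ kc * S ^ 2 := by
      have hbk : b * (1 - ξ) ≤ kc * (1 - x) :=
        mul_le_mul (by linarith) (by linarith) h1ξ.le hkc.le
      calc G * (b * (1 - ξ) * P) ≤ G * (kc * (1 - x) * S) := by gcongr
        _ = kc * S ^ 2 := by rw [hS_def]; ring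
    rw [div_pow, mul_div_assoc', div_le_div_iff₀ (by positivity) (by positivity)]
    calc δ ^ 2 * (b * (1 - ξ) * P) ≤ 2 * G * (b - ξ * Λ) * (b * (1 - ξ) * P) := by gcongr
      _ = 2 * (b - ξ * Λ) * (G * (b * (1 - ξ) * P)) := by ring
      _ ≤ 2 * (b - ξ * Λ) * (kc * S ^ 2) := by gcongr
      _ = kc * (2 * (b - ξ * Λ)) * S ^ 2 := by ring
  have hdiv : 1 - u ≤ δ / S * (1 / t) + 1 / (L * G) := by
    have h1 : 1 - u ≤ (δ + t * (1 - x) / L) / (t * S) := (le_div_iff₀' (by positivity)).2 hstep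
    refine h1.trans_eq ?_
    rw [hS_def]
    field_simp
  have ht_inv : 1 / t = (1 - ξ) * a ^ 2 := by
    rw [ht_def, one_div_div, div_eq_iff (by positivity)]
    linear_combination (-(1 - ξ) * (a * b + 1)) * hab
  rw [ht_inv] at hdiv
  have := mul_le_mul_of_nonneg_right hδS (by positivity : 0 ≤ (1 - ξ) * a ^ 2)
  linarith
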